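/- Let 𝒟 be a finite set of curves such that Γ^n(𝒟) is defined for every n ∈ ℕ. Then there exist n ∈ ℕ and x ∈ ℤ^3 such that every curve of Γ^n(𝒟) contains a point of the cube P_{x,1}. -/

import Mathlib

namespace Folding

noncomputable section

open Set

/-- Points of `ℝ^n` with the euclidean distance. -/
abbrev Pt (n : ℕ) := EuclideanSpace ℝ (Fin n)

/-- `p` is a point of the lattice `ℤ^n`. -/
def latt {n : ℕ} (p : Pt n) : Prop := ∀ i, ∃ m : ℤ, p i = (m : ℝ)

/-- `p` belongs to `m·ℤ^n`. -/
def inLat {n : ℕ} (m : ℕ) (p : Pt n) : Prop := ∀ i, ∃ c : ℤ, p i = (m : ℝ) * (c : ℝ)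

/-- The canonical basis vector `e_i`. -/
def uvec (n : ℕ) (i : Fin n) : Pt n := EuclideanSpace.single i (1 : ℝ)

/-- `u` belongs to `E = {e_1, -e_1, …, e_n, -e_n}`. -/
def IsDir {n : ℕ} (u : Pt n) : Prop := ∃ i, u = uvec n i ∨ u = -uvec n i

/-- A (nonoriented) lattice segment `[x, x + e_i]`, as an unordered pair of endpoints. -/
def IsSeg {n : ℕ} (S : Sym2 (Pt n)) : Prop := ∃ x i, latt x ∧ S = s(x, x + uvec n i)

/-- A curve: a sequence of segments, indexed by an interval of `ℤ` (finite, ℕ-like or ℤ-like),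
recorded through its sequence of vertices; two consecutive segments have exactly one common
endpoint, and the common endpoints with the preceding and the following segments differ
(`noback`). -/
structure Curve (n : ℕ) where
  dom : Set ℤ
  ordConn : dom.OrdConnected
  nontriv : ∃ i, i ∈ dom ∧ i + 1 ∈ dom
  v : ℤ → Pt n
  lattice : ∀ i ∈ dom, latt (v i)
  step : ∀ i : ℤ, i ∈ dom → i + 1 ∈ dom →
    ∃ j, v (i + 1) = v i + uvec n j ∨ v (i + 1) = v i - uvec n j
  noback : ∀ i : ℤ, i - 1 ∈ dom → i + 1 ∈ dom → v (i + 1) ≠ v (i - 1)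

namespace Curve

variable {n : ℕ} (c : Curve n)

/-- The segments of a curve. -/
def segs : Set (Sym2 (Pt n)) :=
  {S | ∃ i : ℤ, i ∈ c.dom ∧ i + 1 ∈ c.dom ∧ S = s(c.v i, c.v (i + 1))}

/-- The connexions between segments of a curve: pairs of consecutive segments. -/
def conn (S T : Sym2 (Pt n)) : Prop :=
  ∃ i : ℤ, i - 1 ∈ c.dom ∧ i + 1 ∈ c.dom ∧
    ((S = s(c.v (i - 1), c.v i) ∧ T = s(c.v i, c.v (i + 1))) ∨
     (T = s(c.v (i - 1), c.v i) ∧ S = s(c.v i, c.v (i + 1))))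

/-- A curve is self-avoiding if each of its segments appears only once. -/
def SelfAvoiding : Prop :=
  ∀ i j : ℤ, i ∈ c.dom → i + 1 ∈ c.dom → j ∈ c.dom → j + 1 ∈ c.dom →
    s(c.v i, c.v (i + 1)) = s(c.v j, c.v (j + 1)) → i = j

/-- A curve without endpoints (indexed by `ℤ`). -/
def NoEndpts : Prop := c.dom = Set.univ

/-- `p` is an endpoint of the curve `c`. -/
def IsEndpt (p : Pt n) : Prop :=
  ∃ i ∈ c.dom, p = c.v i ∧ (i - 1 ∉ c.dom ∨ i + 1 ∉ c.dom)

/-- `S` is the end segment of `c` at its endpoint `p`. -/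
def endSegAt (p : Pt n) (S : Sym2 (Pt n)) : Prop :=
  ∃ i : ℤ, i ∈ c.dom ∧ p = c.v i ∧
    ((i - 1 ∉ c.dom ∧ i + 1 ∈ c.dom ∧ S = s(c.v i, c.v (i + 1))) ∨
     (i + 1 ∉ c.dom ∧ i - 1 ∈ c.dom ∧ S = s(c.v (i - 1), c.v i)))

/-- The number of segments (length) of a curve. -/
def nsegs : ℕ := {i : ℤ | i ∈ c.dom ∧ i + 1 ∈ c.dom}.ncard

end Curve

/-- The trace of a set of curves: its set of segments together with the connexion
relation between segments.  Two sets of curves are geometrically the same set of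
(nonoriented) curves iff they have the same trace. -/
structure Trace (n : ℕ) where
  segs : Set (Sym2 (Pt n))
  conn : Sym2 (Pt n) → Sym2 (Pt n) → Prop

def curveTrace {n : ℕ} (c : Curve n) : Trace n := ⟨c.segs, c.conn⟩

def traceOf {n : ℕ} (E : Set (Curve n)) : Trace n :=
  ⟨{S | ∃ c ∈ E, S ∈ c.segs}, fun S T => ∃ c ∈ E, c.conn S T⟩

/-- Two curves are the same nonoriented curve. -/
def SameCurve {n : ℕ} (c d : Curve n) : Prop := c.segs = d.segs ∧ c.conn = d.conn

/-- A set of pairwise disjoint self-avoiding curves. -/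
def DisjSA {n : ℕ} (E : Set (Curve n)) : Prop :=
  (∀ c ∈ E, c.SelfAvoiding) ∧
  ∀ c ∈ E, ∀ d ∈ E, ¬ SameCurve c d → ∀ S, S ∈ c.segs → S ∉ d.segs

/-- The set of points of `ℝ^n` lying on the segment `S`. -/
def segPts {n : ℕ} (S : Sym2 (Pt n)) : Set (Pt n) :=
  {p | ∃ a b, S = s(a, b) ∧ ∃ t : ℝ, 0 ≤ t ∧ t ≤ 1 ∧ p = a + t • (b - a)}

def Trace.pts {n : ℕ} (T : Trace n) : Set (Pt n) := ⋃ S ∈ T.segs, segPts S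

/-- A set of curves covers `X ⊆ ℝ^n`: each lattice segment containing a point of `X`
appears in one and only one of the curves. -/
def Covers {n : ℕ} (E : Set (Curve n)) (X : Set (Pt n)) : Prop :=
  ∀ S, IsSeg S → (segPts S ∩ X).Nonempty →
    (∃ c ∈ E, S ∈ c.segs) ∧ ∀ c ∈ E, ∀ d ∈ E, S ∈ c.segs → S ∈ d.segs → SameCurve c d

/-- A covering of `ℝ^n` by disjoint self-avoiding curves. -/
def IsCovering {n : ℕ} (E : Set (Curve n)) : Prop := DisjSA E ∧ Covers E Set.univ

/-- A single curve covers `X`. -/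
def CurveCovers {n : ℕ} (c : Curve n) (X : Set (Pt n)) : Prop :=
  ∀ S, IsSeg S → (segPts S ∩ X).Nonempty → S ∈ c.segs

/-- `b` is a curve contained in the curve `a`. -/
def SubCurve {n : ℕ} (b a : Curve n) : Prop :=
  b.segs ⊆ a.segs ∧ ∀ S T, b.conn S T → a.conn S T

/-- The relation `≺` at the level of traces. -/
def TPrec {n : ℕ} (T T' : Trace n) : Prop :=
  T.segs ⊆ T'.segs ∧ ∀ S S', T.conn S S' → T'.conn S S'

/-- `E ≺ F` : each segment of a curve of `E` is a segment of a curve of `F` and each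
connexion between two segments of a curve of `E` also exists in `F`. -/
def Prec {n : ℕ} (E F : Set (Curve n)) : Prop := TPrec (traceOf E) (traceOf F)

/-- Image of a trace under a map of `ℝ^n`. -/
def Trace.map {n : ℕ} (f : Pt n → Pt n) (T : Trace n) : Trace n :=
  ⟨Sym2.map f '' T.segs,
   fun S S' => ∃ A B, T.conn A B ∧ S = Sym2.map f A ∧ S' = Sym2.map f B⟩

/-- Translation of a trace by the vector `t`. -/
def Trace.transl {n : ℕ} (t : Pt n) (T : Trace n) : Trace n := T.map (fun p => p + t)

/-- Property (H) for the pair `(k, l)`. -/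
def SatH {n : ℕ} (A : Set (Curve n)) (k l : ℕ) : Prop :=
  0 < k ∧ 0 < l ∧ k ∣ l ∧ IsCovering A ∧
  (∀ c ∈ A, c.dom.Finite ∧ ∃ x i, latt x ∧ inLat k x ∧ c.IsEndpt x ∧
      c.IsEndpt (x + (k : ℝ) • uvec n i) ∧
      ∀ p, c.IsEndpt p → p = x ∨ p = x + (k : ℝ) • uvec n i) ∧
  (∀ (x : Pt n) (i : Fin n), latt x → inLat k x →
      (∃ c ∈ A, c.IsEndpt x ∧ c.IsEndpt (x + (k : ℝ) • uvec n i)) ∧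
      ∀ c ∈ A, ∀ d ∈ A, c.IsEndpt x → c.IsEndpt (x + (k : ℝ) • uvec n i) →
        d.IsEndpt x → d.IsEndpt (x + (k : ℝ) • uvec n i) → SameCurve c d) ∧
  (∀ t : Pt n, inLat l t → Trace.transl t (traceOf A) = traceOf A)

/-- The trace of the convolution product `A ∗ B`, where `A` satisfies (H) for `(k, l)`:
apply to `B` the homothety of center `0` and ratio `k`, then replace each resulting
segment by the curve of `A` having the same endpoints (connexions come from the curves
of `A`, together with the junctions of the end segments of consecutive `A`-curves). -/
def ConvTrace {n : ℕ} (k : ℕ) (A B : Set (Curve n)) : Trace n where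
  segs := {S | ∃ a b : Pt n, s(a, b) ∈ (traceOf B).segs ∧
    ∃ c ∈ A, c.IsEndpt ((k : ℝ) • a) ∧ c.IsEndpt ((k : ℝ) • b) ∧ S ∈ c.segs}
  conn := fun S S' =>
    (∃ a b : Pt n, s(a, b) ∈ (traceOf B).segs ∧
      ∃ c ∈ A, c.IsEndpt ((k : ℝ) • a) ∧ c.IsEndpt ((k : ℝ) • b) ∧ c.conn S S') ∨
    (∃ a b d : Pt n, (traceOf B).conn s(a, b) s(b, d) ∧
      ∃ c ∈ A, ∃ c' ∈ A, c.IsEndpt ((k : ℝ) • a) ∧ c.IsEndpt ((k : ℝ) • b) ∧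
        c'.IsEndpt ((k : ℝ) • b) ∧ c'.IsEndpt ((k : ℝ) • d) ∧
        ((c.endSegAt ((k : ℝ) • b) S ∧ c'.endSegAt ((k : ℝ) • b) S') ∨
         (c.endSegAt ((k : ℝ) • b) S' ∧ c'.endSegAt ((k : ℝ) • b) S)))

/-- The two-sided identity of the convolution product: the covering consisting of all
curves with one segment. -/
def unitTrace (n : ℕ) : Trace n := ⟨{S | IsSeg S}, fun _ _ => False⟩

/-- `P s` realizes the power `A^s` for the convolution product. -/
def PowersOf {n : ℕ} (A : Set (Curve n)) (k : ℕ) (P : ℕ → Set (Curve n)) : Prop :=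
  (∀ s, DisjSA (P s)) ∧ traceOf (P 0) = unitTrace n ∧
  ∀ s, traceOf (P (s + 1)) = ConvTrace k A (P s)

/-- The trace of `Â`, the inductive limit of the `A^s` for `≺`. -/
def hatTrace {n : ℕ} (P : ℕ → Set (Curve n)) : Trace n :=
  ⟨{S | ∃ s, S ∈ (traceOf (P s)).segs}, fun S T => ∃ s, (traceOf (P s)).conn S T⟩

/-- A pairing relation on `E = {e_1, -e_1, …, e_n, -e_n}`. -/
def IsPairing {n : ℕ} (R : Pt n → Pt n → Prop) : Prop :=
  (∀ u v, R u v → R v u) ∧ (∀ u v, R u v → IsDir u ∧ IsDir v) ∧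
  (∀ u, ¬ R u u) ∧ ∀ u, IsDir u → ∃! v, R u v

/-- The trace of `Â_R` : `Â` with the segments with endpoint `0` connected according
to `R`. -/
def hatRTrace {n : ℕ} (P : ℕ → Set (Curve n)) (R : Pt n → Pt n → Prop) : Trace n :=
  ⟨(hatTrace P).segs,
   fun S T => (hatTrace P).conn S T ∨
     ∃ u v, R u v ∧ S = s((0 : Pt n), u) ∧ T = s((0 : Pt n), v)⟩

/-- The cube `P_{x,h}`. -/
def cube {n : ℕ} (x : Pt n) (h : ℕ) : Set (Pt n) :=
  {p | ∀ i, x i - h ≤ p i ∧ p i ≤ x i + h}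

/-- Restriction of a trace to a region `X` of `ℝ^n`. -/
def Trace.restr {n : ℕ} (T : Trace n) (X : Set (Pt n)) : Trace n :=
  ⟨{S | S ∈ T.segs ∧ segPts S ⊆ X},
   fun S S' => T.conn S S' ∧ segPts S ⊆ X ∧ segPts S' ⊆ X⟩

/-- Condition (C). -/
def CondC {n : ℕ} (T : Trace n) : Prop :=
  ∀ (x : Pt n) (h : ℕ), latt x → 1 ≤ h →
    ∃ y : Pt n, latt y ∧ y ∉ cube x h ∧
      Trace.transl (y - x) (T.restr (cube x h)) = T.restr (cube y h)

/-- `(B(x,r) ∩ T, x) ≅ (B(y,r) ∩ T', y)` : the translation sending `x` to `y` maps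
the part of `T` in the closed ball `B(x,r)` onto the part of `T'` in `B(y,r)`,
preserving the connexions between segments. -/
def BallIso {n : ℕ} (T : Trace n) (x : Pt n) (T' : Trace n) (y : Pt n) (r : ℝ) : Prop :=
  (fun p => p + (y - x)) '' (T.pts ∩ Metric.closedBall x r) =
      T'.pts ∩ Metric.closedBall y r ∧
  (∀ S S', T.conn S S' → segPts S ⊆ Metric.closedBall x r →
      segPts S' ⊆ Metric.closedBall x r →
      T'.conn (Sym2.map (fun p => p + (y - x)) S) (Sym2.map (fun p => p + (y - x)) S')) ∧
  (∀ S S', T'.conn S S' → segPts S ⊆ Metric.closedBall y r →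
      segPts S' ⊆ Metric.closedBall y r →
      T.conn (Sym2.map (fun p => p + (x - y)) S) (Sym2.map (fun p => p + (x - y)) S'))

/-- The local isomorphism property. -/
def LocIsoProp {n : ℕ} (T : Trace n) : Prop :=
  ∀ (x : Pt n) (r : ℝ), 0 ≤ r →
    ∃ t : ℝ, 0 ≤ t ∧ ∀ y : Pt n, ∃ z ∈ Metric.closedBall y t, BallIso T x T z r

/-- Two traces are locally isomorphic. -/
def LocallyIso {n : ℕ} (T T' : Trace n) : Prop :=
  (∀ (x : Pt n) (r : ℝ), 0 ≤ r → ∃ y, BallIso T x T' y r) ∧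
  (∀ (y : Pt n) (r : ℝ), 0 ≤ r → ∃ x, BallIso T' y T x r)

/-- `Ω_{s,x}` : suppress the connexions between segments whose common endpoint lies in
`x + k^s ℤ^n`. -/
def OmegaTrace {n : ℕ} (k s : ℕ) (x : Pt n) (T : Trace n) : Trace n :=
  ⟨T.segs, fun S S' => T.conn S S' ∧ ¬ ∃ p, p ∈ S ∧ p ∈ S' ∧ inLat (k ^ s) (p - x)⟩

/-- `Σ_{s,x}(E)` : for each curve `D` of `E` passing through `x`, the curve(s) with
endpoint `x` contained in `D` having maximal length, this length being limited to
`8^s`. -/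
def SigmaSet {n : ℕ} (s : ℕ) (x : Pt n) (E : Set (Curve n)) : Set (Curve n) :=
  {b | ∃ D ∈ E, SubCurve b D ∧ b.IsEndpt x ∧ b.nsegs ≤ 8 ^ s ∧
    ∀ b' : Curve n, SubCurve b' D → b'.IsEndpt x → b'.nsegs ≤ 8 ^ s →
      SubCurve b b' → SameCurve b b'}

/-- A positive (orientation preserving) isometry of `ℝ^n`. -/
def PosIsom {n : ℕ} (f : Pt n → Pt n) : Prop :=
  ∃ (g : Pt n ≃ₗᵢ[ℝ] Pt n) (t : Pt n), (∀ x, f x = g x + t) ∧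
    0 < LinearMap.det (g.toLinearEquiv.toLinearMap)

/-- `E` consists of exactly `m` curves. -/
def HasExactly {n : ℕ} (E : Set (Curve n)) (m : ℕ) : Prop :=
  ∃ L : List (Curve n), L.length = m ∧ (∀ c ∈ L, c ∈ E) ∧
    L.Pairwise (fun c d => ¬ SameCurve c d) ∧ ∀ c ∈ E, ∃ d ∈ L, SameCurve c d

/-- `E` consists of at most `m` curves. -/
def AtMost {n : ℕ} (E : Set (Curve n)) (m : ℕ) : Prop :=
  ∃ L : List (Curve n), L.length ≤ m ∧ ∀ c ∈ E, ∃ d ∈ L, SameCurve c d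

/-- The set of points of a curve. -/
def curvePts {n : ℕ} (c : Curve n) : Set (Pt n) := ⋃ S ∈ c.segs, segPts S

-- ℝ³-specific part
def toPt3 (f : Fin 3 → ℝ) : Pt 3 := (WithLp.equiv 2 (Fin 3 → ℝ)).symm f

def p3 (a b c : ℤ) : Pt 3 := toPt3 ![(a : ℝ), (b : ℝ), (c : ℝ)]

/-- The vertices of the curve `C`. -/
def CList : List (Pt 3) :=
  [p3 0 0 0, p3 0 (-1) 0, p3 0 (-1) (-1), p3 0 0 (-1), p3 1 0 (-1),
   p3 1 (-1) (-1), p3 1 (-1) 0, p3 1 0 0, p3 2 0 0]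

/-- The block `ℬ₀` : six curves given by their lists of successive vertices. -/
def B0 : List (List (Pt 3)) :=
  [ CList,
    [p3 0 0 0, p3 0 0 1, p3 0 1 1, p3 0 1 0, p3 (-1) 1 0, p3 (-1) 1 1,
     p3 (-1) 0 1, p3 (-1) 0 0, p3 (-2) 0 0],
    [p3 0 0 0, p3 0 0 (-1), p3 (-1) 0 (-1), p3 (-1) 0 0, p3 (-1) 1 0,
     p3 (-1) 1 (-1), p3 0 1 (-1), p3 0 1 0, p3 0 2 0],
    [p3 0 0 0, p3 1 0 0, p3 1 0 1, p3 0 0 1, p3 0 (-1) 1, p3 1 (-1) 1,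
     p3 1 (-1) 0, p3 0 (-1) 0, p3 0 (-2) 0],
    [p3 0 0 0, p3 (-1) 0 0, p3 (-1) (-1) 0, p3 0 (-1) 0, p3 0 (-1) 1,
     p3 (-1) (-1) 1, p3 (-1) 0 1, p3 0 0 1, p3 0 0 2],
    [p3 0 0 0, p3 0 1 0, p3 1 1 0, p3 1 0 0, p3 1 0 (-1), p3 1 1 (-1),
     p3 0 1 (-1), p3 0 0 (-1), p3 0 0 (-2)] ]

def sigma3 : Pt 3 → Pt 3 := fun x => toPt3 ![x 0, -(x 1), -(x 2)]
def tau3 : Pt 3 → Pt 3 := fun x => toPt3 ![x 0, x 2, -(x 1)]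
def ups3 : Pt 3 → Pt 3 := fun x => toPt3 ![x 0, -(x 2), x 1]

/-- The four blocks `ℬ₀, ℬ₁, ℬ₂, ℬ₃`. -/
def blockLists : Fin 4 → List (List (Pt 3)) :=
  ![B0,
    B0.map (List.map fun p => p3 2 2 0 + sigma3 p),
    B0.map (List.map fun p => p3 2 0 2 + tau3 p),
    B0.map (List.map fun p => p3 0 2 2 + ups3 p)]

def listSegs (L : List (Pt 3)) : Set (Sym2 (Pt 3)) :=
  {S | ∃ j : ℕ, j + 1 < L.length ∧ S = s(L.getD j 0, L.getD (j + 1) 0)}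

def listConn (L : List (Pt 3)) (S T : Sym2 (Pt 3)) : Prop :=
  ∃ j : ℕ, j + 2 < L.length ∧
    ((S = s(L.getD j 0, L.getD (j + 1) 0) ∧ T = s(L.getD (j + 1) 0, L.getD (j + 2) 0)) ∨
     (T = s(L.getD j 0, L.getD (j + 1) 0) ∧ S = s(L.getD (j + 1) 0, L.getD (j + 2) 0)))

/-- The trace of the curve given by a list of successive vertices. -/
def listTrace (L : List (Pt 3)) : Trace 3 := ⟨listSegs L, listConn L⟩

/-- The trace of the covering `𝒞 = ⋃_{u ∈ ℤ³, 0 ≤ i ≤ 3} (4u + ℬ_i)`. -/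
def CTrace : Trace 3 where
  segs := {S | ∃ u : Pt 3, latt u ∧ ∃ (i : Fin 4), ∃ M ∈ blockLists i,
    S ∈ (Trace.transl ((4 : ℝ) • u) (listTrace M)).segs}
  conn := fun S T => ∃ u : Pt 3, latt u ∧ ∃ (i : Fin 4), ∃ M ∈ blockLists i,
    (Trace.transl ((4 : ℝ) • u) (listTrace M)).conn S T

open Classical in
/-- The permutation `θ` of `E` with `θ(e₁) = -e₂`, `θ(e₂) = -e₃`, `θ(e₃) = -e₁`
and `θ² = Id`. -/
def theta3 : Pt 3 → Pt 3 := fun u =>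
  if u = uvec 3 0 then -uvec 3 1
  else if u = -uvec 3 1 then uvec 3 0
  else if u = uvec 3 1 then -uvec 3 2
  else if u = -uvec 3 2 then uvec 3 1
  else if u = uvec 3 2 then -uvec 3 0
  else if u = -uvec 3 0 then uvec 3 2
  else u

/-- `R^θ`. -/
def Rtheta (R : Pt 3 → Pt 3 → Prop) : Pt 3 → Pt 3 → Prop :=
  fun u v => R (theta3 u) (theta3 v)

def Rx (P : ℕ → Set (Curve 3)) (x : Pt 3) : Pt 3 → Pt 3 → Prop :=
  fun u v => (hatTrace P).conn s(x, x + u) s(x, x + v)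

/-- Condition (P). -/
def SatP (P : ℕ → Set (Curve 3)) (R : Pt 3 → Pt 3 → Prop) : Prop :=
  ∃ x : Pt 3, (∀ i, x i = -2 ∨ x i = 0 ∨ x i = 2 ∨ x i = 4) ∧
    (¬ ∀ i, x i = 0 ∨ x i = 4) ∧ (Rx P x = R ∨ Rx P x = Rtheta R)

/-- The trace of `Ĉ_X`, the inductive limit of the sets `x_s + 𝒞^s`. -/
def hatXTrace (P : ℕ → Set (Curve 3)) (x : ℕ → Pt 3) : Trace 3 :=
  ⟨{S | ∃ s, 1 ≤ s ∧ S ∈ (Trace.transl (x s) (traceOf (P s))).segs},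
   fun S T => ∃ s, 1 ≤ s ∧ (Trace.transl (x s) (traceOf (P s))).conn S T⟩

/-- The curve `c` is equivalent to `C` (image of `C` by a positive isometry). -/
def EquivToC (c : Curve 3) : Prop :=
  ∃ f, PosIsom f ∧ curveTrace c = Trace.map f (listTrace CList)

/-- `x` is an endpoint of type `0` (resp. `1`) of the curve `c`, for `c`
equivalent to `C`. -/
def EndptType (c : Curve 3) (x : Pt 3) (ty : ℕ) : Prop :=
  ∃ f, PosIsom f ∧ curveTrace c = Trace.map f (listTrace CList) ∧
    x = f (if ty = 0 then p3 0 0 0 else p3 2 0 0)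

/-- The point of `ℤ³ ⊆ ℝ³` with the given integer coordinates. -/
def ofInt (z : Fin 3 → ℤ) : Pt 3 := toPt3 fun k => (z k : ℝ)

@[simp] lemma ofInt_apply (z : Fin 3 → ℤ) (k : Fin 3) : ofInt z k = (z k : ℝ) := rfl

lemma ofInt_injective : Function.Injective ofInt := by
  intro y z h
  funext k
  have := congrArg (fun p : Pt 3 => p k) h
  simpa using this

lemma ofInt_add (y z : Fin 3 → ℤ) : ofInt (y + z) = ofInt y + ofInt z := by
  ext k
  simp

lemma ofInt_zero : ofInt 0 = 0 := by
  ext k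
  simp

lemma ofInt_nsmul (n : ℕ) (z : Fin 3 → ℤ) : ofInt (n • z) = (n : ℝ) • ofInt z := by
  ext k
  simp

lemma intVec_nsmul_apply (n : ℕ) (z : Fin 3 → ℤ) (k : Fin 3) : (n • z) k = n * z k := by
  simp

lemma latt_ofInt (z : Fin 3 → ℤ) : latt (ofInt z) := fun k => ⟨z k, rfl⟩

lemma latt.exists_ofInt {p : Pt 3} (h : latt p) : ∃ z, p = ofInt z := by
  choose z hz using h
  exact ⟨z, by ext k; simp [hz]⟩

lemma p3_eq_ofInt (a b c : ℤ) : p3 a b c = ofInt ![a, b, c] := by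
  ext k
  fin_cases k <;> simp [p3, toPt3]

namespace Curve

variable {n : ℕ} (c : Curve n)

lemma mem_dom_of_conn {i : ℤ} (h : i - 1 ∈ c.dom) (h' : i + 1 ∈ c.dom) : i ∈ c.dom :=
  c.ordConn.out h h' ⟨by omega, by omega⟩

lemma conn_symm {S T : Sym2 (Pt n)} (h : c.conn S T) : c.conn T S := by
  obtain ⟨i, h, h', h''⟩ := h
  exact ⟨i, h, h', h''.symm⟩

lemma left_mem_of_conn {S T : Sym2 (Pt n)} (h : c.conn S T) : S ∈ c.segs := by
  obtain ⟨i, h, h', ⟨rfl, -⟩ | ⟨-, rfl⟩⟩ := h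
  · exact ⟨i - 1, h, by simpa using c.mem_dom_of_conn h h', by simp⟩
  · exact ⟨i, c.mem_dom_of_conn h h', h', rfl⟩

lemma right_mem_of_conn {S T : Sym2 (Pt n)} (h : c.conn S T) : T ∈ c.segs :=
  c.left_mem_of_conn (c.conn_symm h)

/-- The segments of a curve form a single class for the connexion relation. -/
lemma segs_induction {P : Sym2 (Pt n) → Prop} (hP : ∀ S T, c.conn S T → P S → P T)
    {S : Sym2 (Pt n)} (hS : S ∈ c.segs) (h : P S) {T : Sym2 (Pt n)} (hT : T ∈ c.segs) : P T := by
  obtain ⟨i, hi, hi', rfl⟩ := hS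
  obtain ⟨j, hj, hj', rfl⟩ := hT
  have hconn : ∀ k : ℤ, k ∈ c.dom → k + 1 + 1 ∈ c.dom →
      c.conn s(c.v k, c.v (k + 1)) s(c.v (k + 1), c.v (k + 1 + 1)) := fun k hk hk' =>
    ⟨k + 1, by simpa using hk, hk', Or.inl ⟨by simp, rfl⟩⟩
  rcases le_total i j with hij | hij
  · have key : ∀ k, i ≤ k → k ≤ j → P s(c.v k, c.v (k + 1)) := by
      intro k hk
      induction k, hk using Int.leInduction with
      | base => exact fun _ => h
      | succ k hk ih =>
        intro hkj
        refine hP _ _ (hconn k ?_ ?_) (ih (by omega))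
        · exact c.ordConn.out hi hj' ⟨by omega, by omega⟩
        · exact c.ordConn.out hi hj' ⟨by omega, by omega⟩
    exact key j hij le_rfl
  · have key : ∀ k, k ≤ i → j ≤ k → P s(c.v k, c.v (k + 1)) := by
      intro k hk
      induction k, hk using Int.leInductionDown with
      | base => exact fun _ => h
      | pred k hk ih =>
        intro hkj
        have := hconn (k - 1) (c.ordConn.out hj hi' ⟨by omega, by omega⟩)
          (c.ordConn.out hj hi' ⟨by omega, by omega⟩)
        rw [sub_add_cancel] at this ⊢
        exact hP _ _ (c.conn_symm this) (ih (by omega))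
    exact key j hij le_rfl

lemma IsEndpt.exists_mem {c : Curve n} {p : Pt n} (h : c.IsEndpt p) : ∃ S ∈ c.segs, p ∈ S := by
  obtain ⟨i, hi, rfl, -⟩ := h
  obtain ⟨j, hj, hj'⟩ := c.nontriv
  rcases le_or_gt i j with hij | hij
  · exact ⟨_, ⟨i, hi, c.ordConn.out hi hj' ⟨by omega, by omega⟩, rfl⟩, Sym2.mem_mk_left _ _⟩
  · exact ⟨_, ⟨i - 1, c.ordConn.out hj hi ⟨by omega, by omega⟩, by simpa using hi, rfl⟩,
      by simp⟩

lemma segs_nonempty : c.segs.Nonempty := by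
  obtain ⟨j, hj, hj'⟩ := c.nontriv
  exact ⟨_, j, hj, hj', rfl⟩

lemma latt_of_mem_segs {a b : Pt n} (h : s(a, b) ∈ c.segs) : latt a ∧ latt b := by
  obtain ⟨i, hi, hi', h⟩ := h
  rcases Sym2.eq_iff.1 h with ⟨rfl, rfl⟩ | ⟨rfl, rfl⟩
  · exact ⟨c.lattice _ hi, c.lattice _ hi'⟩
  · exact ⟨c.lattice _ hi', c.lattice _ hi⟩

lemma adjacent_of_mem_segs {a b : Pt n} (h : s(a, b) ∈ c.segs) :
    ∃ k, b = a + uvec n k ∨ a = b + uvec n k := by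
  obtain ⟨i, hi, hi', h⟩ := h
  obtain ⟨k, hk⟩ := c.step i hi hi'
  refine ⟨k, ?_⟩
  rcases Sym2.eq_iff.1 h with ⟨rfl, rfl⟩ | ⟨rfl, rfl⟩ <;> rcases hk with hk | hk <;> simp [hk]

lemma ne_of_mem_segs {a b : Pt n} (h : s(a, b) ∈ c.segs) : a ≠ b := by
  rintro rfl
  obtain ⟨k, hk⟩ := c.adjacent_of_mem_segs h
  have h0 : uvec n k = 0 := by simpa using hk
  simpa [uvec] using congrArg (fun p : Pt n => p k) h0

lemma mem_curvePts {p : Pt n} {S : Sym2 (Pt n)} (hS : S ∈ c.segs) (hp : p ∈ S) :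
    p ∈ curvePts c := by
  obtain ⟨q, rfl⟩ := Sym2.mem_iff_exists.1 hp
  exact Set.mem_biUnion hS ⟨p, q, rfl, 0, le_rfl, zero_le_one, by simp⟩

end Curve

/-- The integer coordinates of the vertices of the curves of `ℬ₀`. -/
def intB0 : List (List (Fin 3 → ℤ)) :=
  [ [![0, 0, 0], ![0, -1, 0], ![0, -1, -1], ![0, 0, -1], ![1, 0, -1],
     ![1, -1, -1], ![1, -1, 0], ![1, 0, 0], ![2, 0, 0]],
    [![0, 0, 0], ![0, 0, 1], ![0, 1, 1], ![0, 1, 0], ![-1, 1, 0],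
     ![-1, 1, 1], ![-1, 0, 1], ![-1, 0, 0], ![-2, 0, 0]],
    [![0, 0, 0], ![0, 0, -1], ![-1, 0, -1], ![-1, 0, 0], ![-1, 1, 0],
     ![-1, 1, -1], ![0, 1, -1], ![0, 1, 0], ![0, 2, 0]],
    [![0, 0, 0], ![1, 0, 0], ![1, 0, 1], ![0, 0, 1], ![0, -1, 1],
     ![1, -1, 1], ![1, -1, 0], ![0, -1, 0], ![0, -2, 0]],
    [![0, 0, 0], ![-1, 0, 0], ![-1, -1, 0], ![0, -1, 0], ![0, -1, 1],
     ![-1, -1, 1], ![-1, 0, 1], ![0, 0, 1], ![0, 0, 2]],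
    [![0, 0, 0], ![0, 1, 0], ![1, 1, 0], ![1, 0, 0], ![1, 0, -1],
     ![1, 1, -1], ![0, 1, -1], ![0, 0, -1], ![0, 0, -2]] ]

/-- The affine maps of `ℤ³` sending `ℬ₀` to the blocks `ℬ₀, ℬ₁, ℬ₂, ℬ₃`. -/
def intBlockMap : Fin 4 → (Fin 3 → ℤ) → Fin 3 → ℤ :=
  ![id,
    fun z => ![2 + z 0, 2 - z 1, -z 2],
    fun z => ![2 + z 0, z 2, 2 - z 1],
    fun z => ![z 0, 2 - z 2, 2 + z 1]]

/-- The integer coordinates of the vertices of the 24 curves of the blocks. -/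
def intLists : List (List (Fin 3 → ℤ)) :=
  (List.finRange 4).flatMap fun i => intB0.map (List.map (intBlockMap i))

lemma B0_eq_map : B0 = intB0.map (List.map ofInt) := by
  simp [B0, CList, intB0, p3_eq_ofInt]

lemma blockLists_eq_map (i : Fin 4) :
    blockLists i = (intB0.map (List.map (intBlockMap i))).map (List.map ofInt) := by
  have h1 : (fun p => p3 2 2 0 + sigma3 p) ∘ ofInt = ofInt ∘ intBlockMap 1 := by
    funext z
    ext k
    fin_cases k <;> simp [p3, sigma3, toPt3, intBlockMap, sub_eq_add_neg]
  have h2 : (fun p => p3 2 0 2 + tau3 p) ∘ ofInt = ofInt ∘ intBlockMap 2 := by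
    funext z
    ext k
    fin_cases k <;> simp [p3, tau3, toPt3, intBlockMap, sub_eq_add_neg]
  have h3 : (fun p => p3 0 2 2 + ups3 p) ∘ ofInt = ofInt ∘ intBlockMap 3 := by
    funext z
    ext k
    fin_cases k <;> simp [p3, ups3, toPt3, intBlockMap, sub_eq_add_neg]
  have key : ∀ (f : Pt 3 → Pt 3) (g : (Fin 3 → ℤ) → Fin 3 → ℤ), f ∘ ofInt = ofInt ∘ g →
      B0.map (List.map f) = (intB0.map (List.map g)).map (List.map ofInt) := by
    intro f g h
    simp only [B0_eq_map, List.map_map, List.map_comp_map, h]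
  fin_cases i
  · change B0 = (intB0.map (List.map id)).map (List.map ofInt)
    simp [B0_eq_map]
  · exact key _ _ h1
  · exact key _ _ h2
  · exact key _ _ h3

lemma exists_intLists_of_mem_blockLists {i : Fin 4} {M : List (Pt 3)} (h : M ∈ blockLists i) :
    ∃ L ∈ intLists, M = L.map ofInt := by
  rw [blockLists_eq_map, List.mem_map] at h
  obtain ⟨L, hL, rfl⟩ := h
  exact ⟨L, List.mem_flatMap.2 ⟨i, List.mem_finRange i, hL⟩, rfl⟩

lemma length_of_mem_intLists : ∀ L ∈ intLists, L.length = 9 := by decide +kernel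

/-- The class modulo `8ℤ³` of the sum of the endpoints of the `j`-th segment of `L`, which
characterizes this segment modulo `4ℤ³`, encoded as a natural number. -/
def segKey (L : List (Fin 3 → ℤ)) (j : ℕ) : ℕ :=
  (((L.getD j 0 0 + L.getD (j + 1) 0 0) % 8) + 8 * ((L.getD j 0 1 + L.getD (j + 1) 0 1) % 8) +
    64 * ((L.getD j 0 2 + L.getD (j + 1) 0 2) % 8)).toNat

lemma nodup_segKey : (intLists.flatMap fun L => (List.range 8).map (segKey L)).Nodup := by
  decide +kernel

/-- Two distinct curves of the blocks have no common segment modulo `4ℤ³`. -/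
lemma intLists_disjoint {L L' : List (Fin 3 → ℤ)} (hL : L ∈ intLists) (hL' : L' ∈ intLists)
    {j j' : ℕ} (hj : j < 8) (hj' : j' < 8)
    (h : ∀ k, (L.getD j 0 k + L.getD (j + 1) 0 k) % 8 =
      (L'.getD j' 0 k + L'.getD (j' + 1) 0 k) % 8) :
    L = L' ∧ j = j' := by
  have hkey : segKey L j = segKey L' j' := by simp only [segKey, h]
  obtain ⟨h1, h2⟩ := List.nodup_flatMap.1 nodup_segKey
  have hLL : L = L' := by
    by_contra hne
    have : Std.Symm (Function.onFun List.Disjoint fun L => (List.range 8).map (segKey L)) :=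
      ⟨fun _ _ h => List.Disjoint.symm h⟩
    refine h2.forall hL hL' hne (List.mem_map.2 ⟨j, List.mem_range.2 hj, rfl⟩) ?_
    exact List.mem_map.2 ⟨j', List.mem_range.2 hj', hkey.symm⟩
  subst hLL
  exact ⟨rfl, List.inj_on_of_nodup_map (h1 L hL) (List.mem_range.2 hj) (List.mem_range.2 hj') hkey⟩

lemma eq_endpoint_of_even : ∀ L ∈ intLists, ∀ j < 9, (∀ k, L.getD j 0 k % 2 = 0) →
    L.getD j 0 = L.getD 0 0 ∨ L.getD j 0 = L.getD 8 0 := by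
  decide +kernel

lemma near_endpoint : ∀ L ∈ intLists, ∀ j < 9,
    (∀ k, |L.getD j 0 k - L.getD 0 0 k| ≤ 1) ∨ ∀ k, |L.getD j 0 k - L.getD 8 0 k| ≤ 1 := by
  decide +kernel


/-- `S` is a segment of the curve with vertices `4u + L`. -/
def OnList (u : Fin 3 → ℤ) (L : List (Fin 3 → ℤ)) (S : Sym2 (Pt 3)) : Prop :=
  ∃ j < 8, S = s(ofInt (4 • u + L.getD j 0), ofInt (4 • u + L.getD (j + 1) 0))

lemma OnList.unique {u u' : Fin 3 → ℤ} {L L' : List (Fin 3 → ℤ)} {S : Sym2 (Pt 3)}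
    (hL : L ∈ intLists) (hL' : L' ∈ intLists) (h : OnList u L S) (h' : OnList u' L' S) :
    u = u' ∧ L = L' := by
  obtain ⟨j, hj, rfl⟩ := h
  obtain ⟨j', hj', h'⟩ := h'
  have hsum : ∀ k, 8 * u k + (L.getD j 0 k + L.getD (j + 1) 0 k) =
      8 * u' k + (L'.getD j' 0 k + L'.getD (j' + 1) 0 k) := by
    intro k
    rcases Sym2.eq_iff.1 h' with ⟨h1, h2⟩ | ⟨h1, h2⟩ <;>
    · have e1 := congrFun (ofInt_injective h1) k
      have e2 := congrFun (ofInt_injective h2) k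
      simp only [Pi.add_apply, intVec_nsmul_apply, Nat.cast_ofNat] at e1 e2
      omega
  obtain ⟨rfl, rfl⟩ := intLists_disjoint hL hL' hj hj' fun k => by
    have := hsum k
    omega
  refine ⟨funext fun k => ?_, rfl⟩
  have := hsum k
  omega

lemma mem_of_listConn {M : List (Pt 3)} {S T : Sym2 (Pt 3)} (h : listConn M S T) :
    S ∈ listSegs M ∧ T ∈ listSegs M := by
  obtain ⟨j, hj, ⟨rfl, rfl⟩ | ⟨rfl, rfl⟩⟩ := h
  · exact ⟨⟨j, by omega, rfl⟩, ⟨j + 1, hj, rfl⟩⟩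
  · exact ⟨⟨j + 1, hj, rfl⟩, ⟨j, by omega, rfl⟩⟩

lemma onList_of_mem_listSegs {u : Fin 3 → ℤ} {L : List (Fin 3 → ℤ)} (hL : L ∈ intLists)
    {S : Sym2 (Pt 3)} (hS : S ∈ listSegs (L.map ofInt)) :
    OnList u L (Sym2.map (fun p => p + (4 : ℝ) • ofInt u) S) := by
  obtain ⟨j, hj, rfl⟩ := hS
  rw [List.length_map, length_of_mem_intLists L hL] at hj
  refine ⟨j, by omega, ?_⟩
  simp only [Sym2.map_mk, ofInt_add, ofInt_nsmul, Nat.cast_ofNat, ← ofInt_zero, List.getD_map,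
    add_comm]

lemma exists_onList_of_mem_CTrace {S : Sym2 (Pt 3)} (h : S ∈ CTrace.segs) :
    ∃ u, ∃ L ∈ intLists, OnList u L S := by
  obtain ⟨u, hu, i, M, hM, A, hA, rfl⟩ := h
  obtain ⟨w, rfl⟩ := hu.exists_ofInt
  obtain ⟨L, hL, rfl⟩ := exists_intLists_of_mem_blockLists hM
  exact ⟨w, L, hL, onList_of_mem_listSegs hL hA⟩

lemma exists_onList_of_CTrace_conn {S T : Sym2 (Pt 3)} (h : CTrace.conn S T) :
    ∃ u, ∃ L ∈ intLists, OnList u L S ∧ OnList u L T := by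
  obtain ⟨u, hu, i, M, hM, A, B, hAB, rfl, rfl⟩ := h
  obtain ⟨w, rfl⟩ := hu.exists_ofInt
  obtain ⟨L, hL, rfl⟩ := exists_intLists_of_mem_blockLists hM
  have := mem_of_listConn hAB
  exact ⟨w, L, hL, onList_of_mem_listSegs hL this.1, onList_of_mem_listSegs hL this.2⟩

/-- `S` is a segment of the curve of `𝒞` with endpoints `2a` and `2b`. -/
def Refines (S : Sym2 (Pt 3)) (a b : Fin 3 → ℤ) : Prop :=
  ∃ u, ∃ L ∈ intLists, OnList u L S ∧
    s(2 • a, 2 • b) = s(4 • u + L.getD 0 0, 4 • u + L.getD 8 0)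

lemma Refines.unique {S : Sym2 (Pt 3)} {a b a' b' : Fin 3 → ℤ} (h : Refines S a b)
    (h' : Refines S a' b') : s(a, b) = s(a', b') := by
  obtain ⟨u, L, hL, hS, h⟩ := h
  obtain ⟨u', L', hL', hS', h'⟩ := h'
  obtain ⟨rfl, rfl⟩ := hS.unique hL hL' hS'
  have inj : Function.Injective fun z : Fin 3 → ℤ => 2 • z := by
    intro y z hyz
    funext k
    simpa using congrFun hyz k
  exact Sym2.map.injective inj (by simpa using h.trans h'.symm)

lemma OnList.exists_eq {u : Fin 3 → ℤ} {L : List (Fin 3 → ℤ)} {S : Sym2 (Pt 3)}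
    (h : OnList u L S) {p : Fin 3 → ℤ} (hp : ofInt p ∈ S) :
    ∃ j < 9, p = 4 • u + L.getD j 0 := by
  obtain ⟨j, hj, rfl⟩ := h
  rcases Sym2.mem_iff.1 hp with h | h
  · exact ⟨j, by omega, ofInt_injective h⟩
  · exact ⟨j + 1, by omega, ofInt_injective h⟩

/-- Each vertex of the curve of `𝒞` with endpoints `2a` and `2b` is at distance at most `1`
from one of them for the supremum norm. -/
lemma Refines.near {S : Sym2 (Pt 3)} {a b p : Fin 3 → ℤ} (h : Refines S a b)
    (hp : ofInt p ∈ S) : (∀ k, |p k - 2 * a k| ≤ 1) ∨ ∀ k, |p k - 2 * b k| ≤ 1 := by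
  obtain ⟨u, L, hL, hS, h⟩ := h
  obtain ⟨j, hj, rfl⟩ := hS.exists_eq hp
  have hnear := near_endpoint L hL j hj
  have hsub : ∀ (c : Fin 3 → ℤ) (i : ℕ), 2 • c = 4 • u + L.getD i 0 → ∀ k,
      (4 • u + L.getD j 0) k - 2 * c k = L.getD j 0 k - L.getD i 0 k := by
    intro c i hc k
    have := congrFun hc k
    simp only [Pi.add_apply, intVec_nsmul_apply, Nat.cast_ofNat] at this ⊢
    omega
  rcases Sym2.eq_iff.1 h with ⟨ha, hb⟩ | ⟨ha, hb⟩
  · simpa only [hsub a 0 ha, hsub b 8 hb] using hnear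
  · simpa only [hsub a 8 ha, hsub b 0 hb] using hnear.symm

section Covering

variable {A : Set (Curve 3)}

lemma refines_of_mem (hA : traceOf A = CTrace) {c : Curve 3} (hc : c ∈ A) {a b : Fin 3 → ℤ}
    (hab : a ≠ b) (ha : c.IsEndpt (ofInt (2 • a))) (hb : c.IsEndpt (ofInt (2 • b)))
    {S : Sym2 (Pt 3)} (hS : S ∈ c.segs) : Refines S a b := by
  have hsegs : ∀ {T}, T ∈ c.segs → T ∈ CTrace.segs := fun hT => hA ▸ ⟨c, hc, hT⟩
  have hconn : ∀ {T T'}, c.conn T T' → CTrace.conn T T' := fun hT => hA ▸ ⟨c, hc, hT⟩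
  obtain ⟨u, L, hL, hSL⟩ := exists_onList_of_mem_CTrace (hsegs hS)
  have hall : ∀ T ∈ c.segs, OnList u L T := fun T hT => by
    refine c.segs_induction (P := OnList u L) (fun T T' h hT => ?_) hS hSL hT
    obtain ⟨u', L', hL', h1, h2⟩ := exists_onList_of_CTrace_conn (hconn h)
    obtain ⟨rfl, rfl⟩ := hT.unique hL hL' h1
    exact h2
  have hend : ∀ z : Fin 3 → ℤ, c.IsEndpt (ofInt (2 • z)) →
      2 • z = 4 • u + L.getD 0 0 ∨ 2 • z = 4 • u + L.getD 8 0 := by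
    intro z hz
    obtain ⟨T, hT, hzT⟩ := hz.exists_mem
    obtain ⟨j, hj, h⟩ := (hall T hT).exists_eq hzT
    have heven : ∀ k, L.getD j 0 k % 2 = 0 := by
      intro k
      have := congrFun h k
      simp only [Pi.add_apply, intVec_nsmul_apply, Nat.cast_ofNat] at this
      omega
    rw [h]
    exact (eq_endpoint_of_even L hL j hj heven).imp (congrArg _) (congrArg _)
  have hne : 2 • a ≠ 2 • b := fun h => hab <| funext fun k => by simpa using congrFun h k
  refine ⟨u, L, hL, hSL, Sym2.eq_iff.2 ?_⟩
  rcases hend a ha with h1 | h1 <;> rcases hend b hb with h2 | h2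
  · exact (hne (h1.trans h2.symm)).elim
  · exact Or.inl ⟨h1, h2⟩
  · exact Or.inr ⟨h1, h2⟩
  · exact (hne (h1.trans h2.symm)).elim

lemma exists_isEndpt_of_mem_segs (hH : SatH A 2 4) {d : Curve 3} {a b : Fin 3 → ℤ}
    (h : s(ofInt a, ofInt b) ∈ d.segs) :
    ∃ c ∈ A, c.IsEndpt (ofInt (2 • a)) ∧ c.IsEndpt (ofInt (2 • b)) := by
  have key : ∀ (x y : Fin 3 → ℤ) (k : Fin 3), ofInt y = ofInt x + uvec 3 k →
      ∃ c ∈ A, c.IsEndpt (ofInt (2 • x)) ∧ c.IsEndpt (ofInt (2 • y)) := by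
    intro x y k hxy
    have := (hH.2.2.2.2.2.1 (ofInt (2 • x)) k (latt_ofInt _) fun i => ⟨x i, by simp⟩).1
    simpa only [ofInt_nsmul, hxy, smul_add] using this
  obtain ⟨k, hk | hk⟩ := d.adjacent_of_mem_segs h
  · exact key a b k hk
  · obtain ⟨c, hc, h1, h2⟩ := key b a k hk
    exact ⟨c, hc, h2, h1⟩

lemma mem_segs_of_endSegAt {c : Curve 3} {p : Pt 3} {S : Sym2 (Pt 3)} (h : c.endSegAt p S) :
    S ∈ c.segs := by
  obtain ⟨i, hi, rfl, ⟨-, h, rfl⟩ | ⟨-, h, rfl⟩⟩ := h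
  · exact ⟨i, hi, h, rfl⟩
  · exact ⟨i - 1, h, by simpa using hi, by simp⟩

variable {E F : Set (Curve 3)}

lemma exists_ofInt_of_mem_segs {d : Curve 3} {a b : Pt 3} (h : s(a, b) ∈ d.segs) :
    ∃ a' b', a = ofInt a' ∧ b = ofInt b' ∧ a' ≠ b' := by
  obtain ⟨a', rfl⟩ := (d.latt_of_mem_segs h).1.exists_ofInt
  obtain ⟨b', rfl⟩ := (d.latt_of_mem_segs h).2.exists_ofInt
  exact ⟨a', b', rfl, rfl, fun hab => d.ne_of_mem_segs h (congrArg _ hab)⟩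

/-- In `Δ(F)`, the segments connected to a segment coming from a curve of `F` come from the
same curve. -/
lemma exists_refines_of_conn (hA : traceOf A = CTrace) (hF : DisjSA F) {d : Curve 3} (hd : d ∈ F)
    {S T : Sym2 (Pt 3)} (hconn : (ConvTrace 2 A F).conn S T)
    (hS : ∃ a b, s(ofInt a, ofInt b) ∈ d.segs ∧ Refines S a b) :
    ∃ a b, s(ofInt a, ofInt b) ∈ d.segs ∧ Refines T a b := by
  obtain ⟨a, b, hab, hS⟩ := hS
  have hofInt : ∀ {x y x' y' : Fin 3 → ℤ}, s(x, y) = s(x', y') →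
      s(ofInt x, ofInt y) = s(ofInt x', ofInt y') := fun h => by
    simpa using congrArg (Sym2.map ofInt) h
  have hsame : ∀ {d' : Curve 3} {Q : Sym2 (Pt 3)}, d' ∈ F → Q ∈ d'.segs → Q ∈ d.segs →
      SameCurve d d' := by
    intro d' Q hd' h1 h2
    by_contra h
    exact hF.2 d hd d' hd' h Q h2 h1
  rcases hconn with ⟨a₁, b₁, ⟨d', hd', h⟩, c, hc, ha, hb, hST⟩ |
    ⟨a₁, b₁, b₂, ⟨d', hd', h⟩, c, hc, c', hc', ha, hb, hb', hb₂, hends⟩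
  · obtain ⟨a₁, b₁, rfl, rfl, hne⟩ := exists_ofInt_of_mem_segs h
    rw [← ofInt_nsmul] at ha hb
    have heq := hS.unique (refines_of_mem hA hc hne ha hb (c.left_mem_of_conn hST))
    exact ⟨a₁, b₁, hofInt heq ▸ hab, refines_of_mem hA hc hne ha hb (c.right_mem_of_conn hST)⟩
  · have h1 := d'.left_mem_of_conn h
    have h2 := d'.right_mem_of_conn h
    obtain ⟨a₁, b₁, rfl, rfl, hne⟩ := exists_ofInt_of_mem_segs h1
    obtain ⟨b₁', b₂, hb₁, rfl, hne'⟩ := exists_ofInt_of_mem_segs h2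
    obtain rfl := ofInt_injective hb₁
    rw [← ofInt_nsmul] at ha hb hb' hb₂
    rcases hends with ⟨hS', hT'⟩ | ⟨hT', hS'⟩
    · have heq := hS.unique (refines_of_mem hA hc hne ha hb (mem_segs_of_endSegAt hS'))
      have := hsame hd' h1 (hofInt heq ▸ hab)
      exact ⟨b₁, b₂, this.1 ▸ h2, refines_of_mem hA hc' hne' hb' hb₂ (mem_segs_of_endSegAt hT')⟩
    · have heq := hS.unique (refines_of_mem hA hc' hne' hb' hb₂ (mem_segs_of_endSegAt hS'))
      have := hsame hd' h2 (hofInt heq ▸ hab)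
      exact ⟨a₁, b₁, this.1 ▸ h1, refines_of_mem hA hc hne ha hb (mem_segs_of_endSegAt hT')⟩

/-- Each curve of `F` gives rise to a curve of `E = Δ(F)` all of whose vertices are close to
the image under the homothety of ratio `2` of a vertex of the initial curve. -/
lemma exists_near_curve (hA : traceOf A = CTrace) (hH : SatH A 2 4) (hF : DisjSA F)
    (hE : traceOf E = ConvTrace 2 A F) {d : Curve 3} (hd : d ∈ F) :
    ∃ c ∈ E, ∀ S ∈ c.segs, ∀ p : Fin 3 → ℤ, ofInt p ∈ S →
      ∃ q : Fin 3 → ℤ, (∀ k, |p k - 2 * q k| ≤ 1) ∧ ∃ T ∈ d.segs, ofInt q ∈ T := by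
  obtain ⟨Q, hQ⟩ := d.segs_nonempty
  induction Q using Sym2.ind with | _ x y => ?_
  obtain ⟨a, b, rfl, rfl, hne⟩ := exists_ofInt_of_mem_segs hQ
  obtain ⟨e, he, ha, hb⟩ := exists_isEndpt_of_mem_segs hH hQ
  obtain ⟨S₀, hS₀⟩ := e.segs_nonempty
  have hS₀E : S₀ ∈ (traceOf E).segs := by
    rw [hE]
    refine ⟨ofInt a, ofInt b, ⟨d, hd, hQ⟩, e, he, ?_, ?_, hS₀⟩
    · rwa [← ofInt_nsmul]
    · rwa [← ofInt_nsmul]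
  obtain ⟨c, hc, hS₀c⟩ := hS₀E
  refine ⟨c, hc, fun S hS p hp => ?_⟩
  obtain ⟨a', b', hab', hSab⟩ := c.segs_induction
    (P := fun S => ∃ a b, s(ofInt a, ofInt b) ∈ d.segs ∧ Refines S a b)
    (fun S T hST => exists_refines_of_conn hA hF hd (hE ▸ ⟨c, hc, hST⟩))
    hS₀c ⟨a, b, hQ, refines_of_mem hA he hne ha hb hS₀⟩ hS
  rcases hSab.near hp with h | h
  · exact ⟨a', h, _, hab', Sym2.mem_mk_left _ _⟩
  · exact ⟨b', h, _, hab', Sym2.mem_mk_right _ _⟩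

end Covering

/-- The curves of `E` meet a set of lattice points of diameter at most `r` for the supremum
norm. -/
def MeetsWithin (E : Set (Curve 3)) (r : ℤ) : Prop :=
  ∃ F : Set (Fin 3 → ℤ), (∀ p ∈ F, ∀ q ∈ F, ∀ k, p k ≤ q k + r) ∧
    ∀ c ∈ E, ∃ p ∈ F, ∃ S ∈ c.segs, ofInt p ∈ S

lemma exists_meetsWithin_of_finite {E : Set (Curve 3)} (hE : E.Finite) :
    ∃ r, MeetsWithin E r := by
  have hvert : ∀ c : Curve 3, ∃ p : Fin 3 → ℤ, ∃ S ∈ c.segs, ofInt p ∈ S := by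
    intro c
    obtain ⟨i, hi, hi'⟩ := c.nontriv
    obtain ⟨p, hp⟩ := (c.lattice i hi).exists_ofInt
    exact ⟨p, _, ⟨i, hi, hi', rfl⟩, hp ▸ Sym2.mem_mk_left _ _⟩
  choose f hf using hvert
  have hfin : (f '' E).Finite := hE.image f
  obtain ⟨u, hu⟩ := hfin.bddAbove
  obtain ⟨l, hl⟩ := hfin.bddBelow
  refine ⟨∑ k, |u k - l k|, f '' E, fun p hp q hq k => ?_,
    fun c hc => ⟨f c, Set.mem_image_of_mem f hc, hf c⟩⟩
  have h1 : p k ≤ u k := hu hp k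
  have h2 : l k ≤ q k := hl hq k
  have h3 := le_abs_self (u k - l k)
  have h4 : |u k - l k| ≤ ∑ k, |u k - l k| :=
    Finset.single_le_sum (f := fun k => |u k - l k|) (fun i _ => abs_nonneg _) (Finset.mem_univ k)
  omega

lemma MeetsWithin.of_conv {A E F : Set (Curve 3)} (hA : traceOf A = CTrace) (hH : SatH A 2 4)
    (hF : DisjSA F) (hE : traceOf E = ConvTrace 2 A F) {r : ℤ} (h : MeetsWithin E r) :
    MeetsWithin F ((r + 2) / 2) := by
  obtain ⟨P, hP, hEP⟩ := h
  refine ⟨{q | ∃ p ∈ P, ∀ k, |p k - 2 * q k| ≤ 1}, ?_, ?_⟩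
  · rintro q ⟨p, hp, hpq⟩ q' ⟨p', hp', hpq'⟩ k
    have h1 := abs_le.1 (hpq k)
    have h2 := abs_le.1 (hpq' k)
    have h3 := hP p hp p' hp' k
    omega
  · intro d hd
    obtain ⟨c, hc, hnear⟩ := exists_near_curve hA hH hF hE hd
    obtain ⟨p, hp, S, hS, hpS⟩ := hEP c hc
    obtain ⟨q, hq, hqd⟩ := hnear S hS p hpS
    exact ⟨q, ⟨p, hp, hq⟩, hqd⟩

lemma MeetsWithin.exists_cube {E : Set (Curve 3)} (h : MeetsWithin E 2) :
    ∃ x : Pt 3, latt x ∧ ∀ c ∈ E, (curvePts c ∩ cube x 1).Nonempty := by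
  obtain ⟨P, hP, hEP⟩ := h
  rcases P.eq_empty_or_nonempty with rfl | ⟨p₀, hp₀⟩
  · exact ⟨ofInt 0, latt_ofInt 0, fun c hc => by simpa using hEP c hc⟩
  · have hmin : ∀ k : Fin 3, ∃ m : ℤ, (∃ p ∈ P, p k = m) ∧ ∀ p ∈ P, m ≤ p k := by
      intro k
      obtain ⟨m, hm, hmin⟩ := Int.exists_least_of_bdd (P := fun m => ∃ p ∈ P, p k = m)
        ⟨p₀ k - 2, by
          rintro _ ⟨p, hp, rfl⟩
          have := hP p₀ hp₀ p hp k
          omega⟩ ⟨p₀ k, p₀, hp₀, rfl⟩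
      exact ⟨m, hm, fun p hp => hmin _ ⟨p, hp, rfl⟩⟩
    choose m hm hmin using hmin
    refine ⟨ofInt fun k => m k + 1, latt_ofInt _, fun c hc => ?_⟩
    obtain ⟨p, hp, S, hS, hpS⟩ := hEP c hc
    refine ⟨ofInt p, c.mem_curvePts hS hpS, fun k => ?_⟩
    obtain ⟨q, hq, hqk⟩ := hm k
    have h1 : m k ≤ p k := hmin k p hp
    have h2 : p k ≤ m k + 2 := hqk ▸ hP p hp q hq k
    have h1' : (m k : ℝ) ≤ p k := by exact_mod_cast h1
    have h2' : (p k : ℝ) ≤ m k + 2 := by exact_mod_cast h2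
    simp only [ofInt_apply]
    push_cast
    constructor <;> linarith

lemma MeetsWithin.mono {E : Set (Curve 3)} {r s : ℤ} (h : MeetsWithin E r) (hrs : r ≤ s) :
    MeetsWithin E s := by
  obtain ⟨P, hP, hEP⟩ := h
  exact ⟨P, fun p hp q hq k => (hP p hp q hq k).trans (by omega), hEP⟩

/-- Proposition 2.10: if `𝒟` is a finite set of curves such that
`Γⁿ(𝒟)` is defined for each `n ∈ ℕ`, then there exist `n ∈ ℕ` and `x ∈ ℤ³` such that
each curve of `Γⁿ(𝒟)` contains a point of `P_{x,1}`.  Here `D m` realizes `Γᵐ(𝒟)`: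
`D 0 = 𝒟` and `Δ(D (m+1)) = D m`. -/
theorem statement17 (C3 : Set (Curve 3)) (hC3 : traceOf C3 = CTrace)
    (hH : SatH C3 2 4)
    (Dset : Set (Curve 3)) (hfin : Dset.Finite) (hdisj : DisjSA Dset)
    (D : ℕ → Set (Curve 3)) (hD0 : D 0 = Dset)
    (hchain : ∀ m : ℕ, DisjSA (D (m + 1)) ∧
      traceOf (D m) = ConvTrace 2 C3 (D (m + 1))) :
    ∃ (m : ℕ) (x : Pt 3), latt x ∧
      ∀ c ∈ D m, (curvePts c ∩ cube x 1).Nonempty := by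
  have key : ∀ (r : ℕ) (m : ℕ), MeetsWithin (D m) r → ∃ m', MeetsWithin (D m') 2 := by
    intro r
    induction r using Nat.strong_induction_on with
    | _ r ih =>
      intro m hm
      by_cases hr : r ≤ 2
      · exact ⟨m, hm.mono (by omega)⟩
      · exact ih ((r + 2) / 2) (by omega) (m + 1)
          (by exact_mod_cast hm.of_conv hC3 hH (hchain m).1 (hchain m).2)
  obtain ⟨r, hr⟩ := exists_meetsWithin_of_finite (hD0 ▸ hfin : (D 0).Finite)
  obtain ⟨m, hm⟩ := key r.toNat 0 (hr.mono (Int.self_le_toNat r))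
  exact ⟨m, hm.exists_cube⟩

end
end Folding
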